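/- Define, for a finite set r of positive integers ≤ n: T³_{n,r} = {x ∈ T_n : x₁, x₂, x₃ ∈ r and r ⊆ Set(x)}; T^{4'}_{n,r} = ∪_{k₀=4}^{2g+4} {x ∈ T³_{n,r} : x_{k₀} ∈ r and, for some 2 ≤ j ≤ g+1, x_{2j+1} ∉ r and x_{2j+2} ∉ r}; T^{4''}_{n,r} = {x ∈ T³_{n,r} : x_{2j+1} = x_{2j+2} ∉ r for some 2 ≤ j ≤ g+1}; T⁴_{n,r} = T^{4'}_{n,r} ∪ T^{4''}_{n,r}; T⁵_{n,r} = T³_{n,r} \ T⁴_{n,r}. Then there exists δ_g > 0 depending only on g such that for every real λ > 1 there exist a constant C > 0 and a threshold n₀ with: for every integer n ≥ n₀ and every such r with 3 ≤ |r| ≤ 2g+4, one has ∑_{x ∈ T⁴_{n,r}} ∏_{y ∈ Set(x) \ r} λ^{-1} y^{-α} ≤ C · n^{-δ_g} and ∑_{x ∈ T⁵_{n,r}} ∏_{y ∈ Set(x) \ r} λ^{-1} y^{-α} ≤ C, the constants being independent of r. -/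

import Mathlib

noncomputable section

open Real MeasureTheory ProbabilityTheory

def IsSidonZ {M : ℕ} (S : Set (ZMod M)) : Prop :=
  ∀ a ∈ S, ∀ b ∈ S, ∀ c ∈ S, ∀ d ∈ S, a + b = c + d → ({a, b} : Set (ZMod M)) = {c, d}

def Covers3 {M : ℕ} (S : Set (ZMod M)) : Prop :=
  ∀ z : ZMod M, ∃ s₁ ∈ S, ∃ s₂ ∈ S, ∃ s₃ ∈ S,
    s₁ ≠ s₂ ∧ s₁ ≠ s₃ ∧ s₂ ≠ s₃ ∧ z = s₁ + s₂ + s₃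

def alph (g : ℕ) : ℝ := ((g : ℝ) + 1) / (2 * (g : ℝ) + 1)

def glam (g : ℕ) (lam : ℝ) (n : ℕ) : ℝ :=
  lam ^ ((2 * (g : ℝ) + 5) / (1 - alph g)) * (n : ℝ) ^ ((1 : ℝ) / (g : ℝ)) *
    Real.log n ^ ((1 : ℝ) / (1 - alph g))

def GoodS (M : ℕ) (CM : Set (ZMod M)) (s : ℕ → Fin 3 → ZMod M) : Prop :=
  ∀ n : ℕ, (∀ i, s n i ∈ CM) ∧ s n 0 ≠ s n 1 ∧ s n 0 ≠ s n 2 ∧ s n 1 ≠ s n 2 ∧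
    s n 0 + s n 1 + s n 2 = (n : ZMod M)

def Rtrip (g M : ℕ) (lam : ℝ) (s : ℕ → Fin 3 → ZMod M) (n x₁ x₂ x₃ : ℕ) : Prop :=
  0 < x₁ ∧ 0 < x₂ ∧ 0 < x₃ ∧ x₁ + x₂ + x₃ = n ∧
  glam g lam n / 2 ≤ (x₁ : ℝ) ∧ (x₁ : ℝ) ≤ glam g lam n ∧
  (n : ℝ) / 4 ≤ (x₂ : ℝ) ∧ x₂ ≤ n ∧ (n : ℝ) / 4 ≤ (x₃ : ℝ) ∧ x₃ ≤ n ∧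
  (x₁ : ZMod M) = s n 0 ∧ (x₂ : ZMod M) = s n 1 ∧ (x₃ : ZMod M) = s n 2

def Rn (g M : ℕ) (lam : ℝ) (s : ℕ → Fin 3 → ZMod M) (n : ℕ) : Set (Finset ℕ) :=
  {ω | ∃ x₁ x₂ x₃ : ℕ, ω = {x₁, x₂, x₃} ∧ Rtrip g M lam s n x₁ x₂ x₃}

def imgF {m : ℕ} (x : Fin m → ℕ) : Finset ℕ := Finset.image x Finset.univ

def firstThree (g : ℕ) (x : Fin (2 * g + 4) → ℕ) : Finset ℕ :=
  {x ⟨0, by omega⟩, x ⟨1, by omega⟩, x ⟨2, by omega⟩}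

def pairOf (g : ℕ) (x : Fin (2 * g + 4) → ℕ) (j : ℕ) : Finset ℕ :=
  if j = 0 then {x ⟨0, by omega⟩, x ⟨3, by omega⟩}
  else if h : j ≤ g then {x ⟨2 * j + 2, by omega⟩, x ⟨2 * j + 3, by omega⟩}
  else ∅

def Tn (g M : ℕ) (lam : ℝ) (s : ℕ → Fin 3 → ZMod M) (n : ℕ) :
    Set (Fin (2 * g + 4) → ℕ) :=
  {x | (∀ i, 0 < x i) ∧
    firstThree g x ∈ Rn g M lam s n ∧
    (∀ j : ℕ, 2 ≤ j → ∀ _ : j ≤ g + 1,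
      x ⟨0, by omega⟩ + x ⟨3, by omega⟩ = x ⟨2 * j, by omega⟩ + x ⟨2 * j + 1, by omega⟩) ∧
    (∀ i : Fin (2 * g + 4), 3 ≤ (i : ℕ) → x i ≤ x ⟨0, by omega⟩) ∧
    (∀ k : ℕ, 2 ≤ k → ∀ _ : k ≤ g + 1,
      (x ⟨2 * k, by omega⟩ : ZMod M) = (x ⟨0, by omega⟩ : ZMod M) ∧
      (x ⟨2 * k + 1, by omega⟩ : ZMod M) = (x ⟨3, by omega⟩ : ZMod M)) ∧
    (∀ j k : ℕ, j ≤ g → k ≤ g → j ≠ k → pairOf g x j ≠ pairOf g x k)}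

def TnInd (g M : ℕ) (lam : ℝ) (s : ℕ → Fin 3 → ZMod M) (n : ℕ) :
    Set (Fin (2 * g + 4) → ℕ) :=
  {x ∈ Tn g M lam s n | Function.Injective x}

def TnDep (g M : ℕ) (lam : ℝ) (s : ℕ → Fin 3 → ZMod M) (n : ℕ) :
    Set (Fin (2 * g + 4) → ℕ) :=
  {x ∈ Tn g M lam s n | ¬ Function.Injective x}

def Vr (g : ℕ) (r₁ : ℕ) : Set (Fin (2 * g + 1) → ℕ) :=
  {v | (∀ i, 0 < v i) ∧
    (∀ t : ℕ, ∀ _ : t < g,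
      r₁ + v ⟨0, by omega⟩ = v ⟨2 * t + 1, by omega⟩ + v ⟨2 * t + 2, by omega⟩) ∧
    (∀ i, v i ≤ r₁) ∧ Function.Injective v ∧ (∀ i, v i ≠ r₁)}

def Tcal (X r : Finset ℕ) (k : ℕ) (eps : ℕ → ℤ) : Set (ℕ → ℕ) :=
  {y | (∀ j < k, y j ∈ X ∪ r) ∧ (∀ j, k ≤ j → y j = 0) ∧ (∃ j < k, y j ∈ X) ∧
    (∀ i < k, ∀ j < k, y i = y j → eps i = eps j)}

def Fval (k : ℕ) (eps : ℕ → ℤ) (y : ℕ → ℕ) : ℤ :=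
  ∑ j ∈ Finset.range k, eps j * (y j : ℤ)

def Ccal (U X r : Finset ℕ) : Set (Finset ℕ) :=
  {w | w.card = 4 ∧ w ⊆ U ∧ (∃ a ∈ w, a ∈ X ∧ a ∉ r) ∧
    ∃ y₁ y₂ y₃ y₄ : ℕ, w = {y₁, y₂, y₃, y₄} ∧ y₁ + y₂ = y₃ + y₄ ∧
      ({y₁, y₂} : Finset ℕ) ≠ {y₃, y₄}}

def CcalR (g M : ℕ) (lam : ℝ) (s : ℕ → Fin 3 → ZMod M) (n : ℕ) (X r : Finset ℕ) :
    Set (Finset ℕ) :=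
  {w | w ∈ Rn g M lam s n ∧ w ⊆ X ∪ r ∧ ∃ a ∈ w, a ∈ X ∧ a ∉ r}

def Sx (g : ℕ) (x : Fin (2 * g + 4) → ℕ) : Set (Finset ℕ) :=
  {w | ∃ l : ℕ, ∃ _ : 3 ≤ l, ∃ _ : l ≤ g + 2,
      w = ({x ⟨0, by omega⟩, x ⟨3, by omega⟩,
            x ⟨2 * l - 2, by omega⟩, x ⟨2 * l - 1, by omega⟩} : Finset ℕ)} ∪
  {w | ∃ l j : ℕ, ∃ _ : 3 ≤ l, ∃ _ : l < j, ∃ _ : j ≤ g + 2,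
      w = ({x ⟨2 * j - 2, by omega⟩, x ⟨2 * j - 1, by omega⟩,
            x ⟨2 * l - 2, by omega⟩, x ⟨2 * l - 1, by omega⟩} : Finset ℕ)}

def SxV (g : ℕ) (r₁ : ℕ) (v : Fin (2 * g + 1) → ℕ) : Set (Finset ℕ) :=
  {w | ∃ l : ℕ, ∃ _ : 3 ≤ l, ∃ _ : l ≤ g + 2,
      w = ({r₁, v ⟨0, by omega⟩, v ⟨2 * l - 5, by omega⟩, v ⟨2 * l - 4, by omega⟩} : Finset ℕ)} ∪
  {w | ∃ l j : ℕ, ∃ _ : 3 ≤ l, ∃ _ : l < j, ∃ _ : j ≤ g + 2,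
      w = ({v ⟨2 * j - 5, by omega⟩, v ⟨2 * j - 4, by omega⟩,
            v ⟨2 * l - 5, by omega⟩, v ⟨2 * l - 4, by omega⟩} : Finset ℕ)}

def tailSet (g : ℕ) (x : Fin (2 * g + 4) → ℕ) : Finset ℕ :=
  Finset.image (fun i : Fin (2 * g + 1) => x ⟨(i : ℕ) + 3, by have := i.isLt; omega⟩)
    Finset.univ

/-- `T³_{n,r}`. -/
def T3 (g M : ℕ) (lam : ℝ) (s : ℕ → Fin 3 → ZMod M) (n : ℕ) (r : Finset ℕ) :
    Set (Fin (2 * g + 4) → ℕ) :=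
  {x ∈ Tn g M lam s n |
    x ⟨0, by omega⟩ ∈ r ∧ x ⟨1, by omega⟩ ∈ r ∧ x ⟨2, by omega⟩ ∈ r ∧ r ⊆ imgF x}

/-- `T⁴'_{n,r}`. -/
def T4' (g M : ℕ) (lam : ℝ) (s : ℕ → Fin 3 → ZMod M) (n : ℕ) (r : Finset ℕ) :
    Set (Fin (2 * g + 4) → ℕ) :=
  {x ∈ T3 g M lam s n r |
    (∃ i : Fin (2 * g + 4), 3 ≤ (i : ℕ) ∧ x i ∈ r) ∧
    ∃ j : ℕ, ∃ _ : 2 ≤ j, ∃ _ : j ≤ g + 1,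
      x ⟨2 * j, by omega⟩ ∉ r ∧ x ⟨2 * j + 1, by omega⟩ ∉ r}

/-- `T⁴''_{n,r}`. -/
def T4'' (g M : ℕ) (lam : ℝ) (s : ℕ → Fin 3 → ZMod M) (n : ℕ) (r : Finset ℕ) :
    Set (Fin (2 * g + 4) → ℕ) :=
  {x ∈ T3 g M lam s n r |
    ∃ j : ℕ, ∃ _ : 2 ≤ j, ∃ _ : j ≤ g + 1,
      x ⟨2 * j, by omega⟩ = x ⟨2 * j + 1, by omega⟩ ∧ x ⟨2 * j, by omega⟩ ∉ r}

/-- `T⁴_{n,r}`. -/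
def T4 (g M : ℕ) (lam : ℝ) (s : ℕ → Fin 3 → ZMod M) (n : ℕ) (r : Finset ℕ) :
    Set (Fin (2 * g + 4) → ℕ) :=
  T4' g M lam s n r ∪ T4'' g M lam s n r

/-- `T⁵_{n,r}`. -/
def T5 (g M : ℕ) (lam : ℝ) (s : ℕ → Fin 3 → ZMod M) (n : ℕ) (r : Finset ℕ) :
    Set (Fin (2 * g + 4) → ℕ) :=
  T3 g M lam s n r \ T4 g M lam s n r

/-- The weight of `y` relative to `r`: elements of `r` are free, others cost `y ^ (-al)`. -/
def wt (al : ℝ) (r : Finset ℕ) (y : ℕ) : ℝ := if y ∈ r then 1 else (y : ℝ) ^ (-al)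

/-- The weight of the set `{a, m - a}`. -/
def pairWt (al : ℝ) (r : Finset ℕ) (m a : ℕ) : ℝ := ∏ y ∈ ({a, m - a} : Finset ℕ), wt al r y

/-- Left entries of pairs in `[u, N]` with sum `N + u` avoiding `r`. -/
def pairsOut (r : Finset ℕ) (N u : ℕ) : Finset ℕ :=
  (Finset.Icc u N).filter fun a => a ∉ r ∧ N + u - a ∉ r

/-- Left entries of pairs in `[u, N]` with sum `N + u` meeting `r`. -/
def pairsIn (r : Finset ℕ) (N u : ℕ) : Finset ℕ :=
  (Finset.Icc u N).filter fun a => a ∈ r ∨ N + u - a ∈ r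

/-- Entries of constant pairs with sum `N + u` avoiding `r`. -/
def pairsEq (r : Finset ℕ) (N u : ℕ) : Finset ℕ :=
  (Finset.Icc u N).filter fun a => a + a = N + u ∧ a ∉ r

section Weights

variable {al : ℝ} {r : Finset ℕ}

lemma wt_nonneg (y : ℕ) : 0 ≤ wt al r y := by
  unfold wt; split_ifs <;> positivity

lemma wt_le_one (hal : 0 < al) (y : ℕ) : wt al r y ≤ 1 := by
  unfold wt
  split_ifs
  · exact le_rfl
  · rcases Nat.eq_zero_or_pos y with rfl | hy
    · rw [Nat.cast_zero, Real.zero_rpow (by linarith)]; exact zero_le_one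
    · exact Real.rpow_le_one_of_one_le_of_nonpos (by exact_mod_cast hy) (by linarith)

lemma wt_of_not_mem {y : ℕ} (hy : y ∉ r) : wt al r y = (y : ℝ) ^ (-al) := if_neg hy

lemma pairWt_nonneg (m a : ℕ) : 0 ≤ pairWt al r m a :=
  Finset.prod_nonneg fun y _ => wt_nonneg y

lemma pairWt_le_of_mem (hal : 0 < al) {m a y : ℕ} (hy : y ∈ ({a, m - a} : Finset ℕ)) :
    pairWt al r m a ≤ wt al r y := by
  unfold pairWt
  rw [← Finset.mul_prod_erase _ _ hy]
  exact mul_le_of_le_one_right (wt_nonneg y)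
    (Finset.prod_le_one (fun i _ => wt_nonneg i) fun i _ => wt_le_one hal i)

lemma pairWt_le_one (hal : 0 < al) (m a : ℕ) : pairWt al r m a ≤ 1 :=
  (pairWt_le_of_mem hal (Finset.mem_insert_self a _)).trans (wt_le_one hal a)

lemma sum_Icc_rpow_neg_le (hal : 0 < al) (hal1 : al < 1) (N : ℕ) :
    ∑ u ∈ Finset.Icc 1 N, (u : ℝ) ^ (-al) ≤ (1 - al)⁻¹ * (N : ℝ) ^ (1 - al) := by
  have h1 : 0 < 1 - al := by linarith
  induction N with
  | zero => simp; positivity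
  | succ N ih =>
    rw [Finset.sum_Icc_succ_top (by omega)]
    have hN : (0 : ℝ) < ((N + 1 : ℕ) : ℝ) := by positivity
    have hq : -1 ≤ -(((N + 1 : ℕ) : ℝ)⁻¹) := by
      rw [neg_le_neg_iff]; exact inv_le_one_of_one_le₀ (by push_cast; linarith [N.cast_nonneg (α := ℝ)])
    have hb := rpow_one_add_le_one_add_mul_self hq h1.le (by linarith)
    have hfac : (N : ℝ) = ((N + 1 : ℕ) : ℝ) * (1 + -(((N + 1 : ℕ) : ℝ)⁻¹)) := by
      field_simp; push_cast; ring
    have hle : (N : ℝ) ^ (1 - al) ≤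
        ((N + 1 : ℕ) : ℝ) ^ (1 - al) - (1 - al) * ((N + 1 : ℕ) : ℝ) ^ (-al) := by
      have hp : ((N + 1 : ℕ) : ℝ) ^ (-al) =
          ((N + 1 : ℕ) : ℝ) ^ (1 - al) * ((N + 1 : ℕ) : ℝ)⁻¹ := by
        rw [← Real.rpow_neg_one, ← Real.rpow_add hN]; congr 1; ring
      calc (N : ℝ) ^ (1 - al)
          = ((N + 1 : ℕ) : ℝ) ^ (1 - al) * (1 + -(((N + 1 : ℕ) : ℝ)⁻¹)) ^ (1 - al) := by
            rw [← Real.mul_rpow hN.le (by linarith), ← hfac]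
        _ ≤ ((N + 1 : ℕ) : ℝ) ^ (1 - al) * (1 + (1 - al) * -(((N + 1 : ℕ) : ℝ)⁻¹)) := by
            gcongr
        _ = _ := by rw [hp]; ring
    have hmul := mul_le_mul_of_nonneg_left hle (inv_nonneg.2 h1.le)
    rw [mul_sub, ← mul_assoc, inv_mul_cancel₀ h1.ne', one_mul] at hmul
    linarith

lemma rpow_neg_le_of_half_le (hal : 0 < al) {N y : ℕ} (hN : 1 ≤ N) (h : N ≤ 2 * y) :
    (y : ℝ) ^ (-al) ≤ 2 ^ al * (N : ℝ) ^ (-al) := by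
  have hN' : (0 : ℝ) < N := by exact_mod_cast hN
  have h' : (N : ℝ) / 2 ≤ y := by
    have : (N : ℝ) ≤ 2 * y := by exact_mod_cast h
    linarith
  calc (y : ℝ) ^ (-al) ≤ ((N : ℝ) / 2) ^ (-al) :=
        Real.rpow_le_rpow_of_nonpos (by positivity) h' (by linarith)
    _ = 2 ^ al * (N : ℝ) ^ (-al) := by
        rw [Real.div_rpow hN'.le (by norm_num), Real.rpow_neg (by norm_num : (0 : ℝ) ≤ 2),
          div_inv_eq_mul, mul_comm]

lemma sum_pairsEq_le (hal : 0 < al) {N u : ℕ} (hN : 1 ≤ N) :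
    ∑ a ∈ pairsEq r N u, pairWt al r (N + u) a ≤ 2 ^ al * (N : ℝ) ^ (-al) := by
  have hcard : (pairsEq r N u).card ≤ 1 := by
    rw [Finset.card_le_one]
    intro a ha b hb
    simp only [pairsEq, Finset.mem_filter] at ha hb
    omega
  have hterm : ∀ a ∈ pairsEq r N u, pairWt al r (N + u) a ≤ 2 ^ al * (N : ℝ) ^ (-al) := by
    intro a ha
    simp only [pairsEq, Finset.mem_filter] at ha
    refine (pairWt_le_of_mem hal (Finset.mem_insert_self a _)).trans ?_
    rw [wt_of_not_mem ha.2.2]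
    exact rpow_neg_le_of_half_le hal hN (by omega)
  calc _ ≤ (pairsEq r N u).card • (2 ^ al * (N : ℝ) ^ (-al)) :=
        Finset.sum_le_card_nsmul _ _ _ hterm
    _ ≤ 1 • (2 ^ al * (N : ℝ) ^ (-al)) := nsmul_le_nsmul_left (by positivity) hcard
    _ = _ := one_nsmul _

lemma sum_reflect_le {f : ℕ → ℝ} (hf : ∀ y, 0 ≤ f y) {N u : ℕ} (hu : 1 ≤ u) :
    ∑ a ∈ Finset.Icc u N, f (N + u - a) ≤ ∑ a ∈ Finset.Icc 1 N, f a := by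
  have hinj : Set.InjOn (fun a => N + u - a) (Finset.Icc u N : Finset ℕ) := by
    intro a ha b hb hab
    simp only [Finset.coe_Icc, Set.mem_Icc] at ha hb hab
    omega
  rw [← Finset.sum_image (f := f) hinj]
  refine Finset.sum_le_sum_of_subset_of_nonneg ?_ fun _ _ _ => hf _
  intro y hy
  simp only [Finset.mem_image, Finset.mem_Icc] at hy ⊢
  obtain ⟨a, ha, rfl⟩ := hy
  omega

/-- The constant in the bound for pairs avoiding `r`. -/
def outConst (al : ℝ) : ℝ := 2 ^ al * (2 * (1 - al)⁻¹ + 1)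

lemma outConst_nonneg (hal1 : al < 1) : 0 ≤ outConst al := by
  have : 0 < 1 - al := by linarith
  unfold outConst; positivity

lemma sum_pairsOut_le (hal : 0 < al) (hal1 : al < 1) {N u : ℕ} (hN : 1 ≤ N) (hu : 1 ≤ u) :
    ∑ a ∈ pairsOut r N u, pairWt al r (N + u) a ≤ outConst al * (N : ℝ) ^ (1 - 2 * al) := by
  have hN0 : (0 : ℝ) < N := by exact_mod_cast hN
  have hN1 : (1 : ℝ) ≤ N := by exact_mod_cast hN
  set c : ℝ := 2 ^ al * (N : ℝ) ^ (-al) with hc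
  have hc0 : 0 ≤ c := by positivity
  have hsub : pairsOut r N u ⊆ pairsEq r N u ∪
      (pairsOut r N u).filter (fun a => a ≠ N + u - a) := by
    intro a ha
    simp only [Finset.mem_union, Finset.mem_filter, pairsEq, pairsOut, Finset.mem_Icc] at ha ⊢
    by_cases h : a = N + u - a
    · left; refine ⟨ha.1, by omega, ha.2.1⟩
    · right; exact ⟨ha, h⟩
  have hne : ∀ a ∈ (pairsOut r N u).filter (fun a => a ≠ N + u - a),
      pairWt al r (N + u) a ≤ c * ((a : ℝ) ^ (-al) + ((N + u - a : ℕ) : ℝ) ^ (-al)) := by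
    intro a ha
    simp only [Finset.mem_filter, pairsOut, Finset.mem_Icc] at ha
    obtain ⟨⟨h1, h2, h3⟩, h4⟩ := ha
    unfold pairWt
    rw [Finset.prod_pair h4, wt_of_not_mem h2, wt_of_not_mem h3]
    have ha0 : 0 ≤ (a : ℝ) ^ (-al) := by positivity
    have hb0 : 0 ≤ ((N + u - a : ℕ) : ℝ) ^ (-al) := by positivity
    rcases le_total (N + u) (2 * a) with h | h
    · have := rpow_neg_le_of_half_le hal hN (show N ≤ 2 * a by omega)
      nlinarith
    · have := rpow_neg_le_of_half_le hal hN (show N ≤ 2 * (N + u - a) by omega)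
      nlinarith
  have hIcc : (pairsOut r N u).filter (fun a => a ≠ N + u - a) ⊆ Finset.Icc u N :=
    (Finset.filter_subset _ _).trans (Finset.filter_subset _ _)
  have hS := sum_Icc_rpow_neg_le hal hal1 N
  have hpow : (N : ℝ) ^ (-al) * (N : ℝ) ^ (1 - al) = (N : ℝ) ^ (1 - 2 * al) := by
    rw [← Real.rpow_add hN0]; congr 1; ring
  have hpow' : (N : ℝ) ^ (-al) ≤ (N : ℝ) ^ (1 - 2 * al) :=
    Real.rpow_le_rpow_of_exponent_le hN1 (by linarith)
  have hmain : ∑ a ∈ (pairsOut r N u).filter (fun a => a ≠ N + u - a), pairWt al r (N + u) a ≤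
      c * (2 * ((1 - al)⁻¹ * (N : ℝ) ^ (1 - al))) := by
    calc _ ≤ ∑ a ∈ (pairsOut r N u).filter (fun a => a ≠ N + u - a),
          c * ((a : ℝ) ^ (-al) + ((N + u - a : ℕ) : ℝ) ^ (-al)) := Finset.sum_le_sum hne
      _ ≤ ∑ a ∈ Finset.Icc u N, c * ((a : ℝ) ^ (-al) + ((N + u - a : ℕ) : ℝ) ^ (-al)) :=
          Finset.sum_le_sum_of_subset_of_nonneg hIcc fun _ _ _ => by positivity
      _ = c * (∑ a ∈ Finset.Icc u N, (a : ℝ) ^ (-al) +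
            ∑ a ∈ Finset.Icc u N, ((N + u - a : ℕ) : ℝ) ^ (-al)) := by
          rw [← Finset.mul_sum, Finset.sum_add_distrib]
      _ ≤ _ := by
          have e1 : ∑ a ∈ Finset.Icc u N, (a : ℝ) ^ (-al) ≤
              ∑ a ∈ Finset.Icc 1 N, (a : ℝ) ^ (-al) :=
            Finset.sum_le_sum_of_subset_of_nonneg (Finset.Icc_subset_Icc_left hu)
              fun _ _ _ => by positivity
          have e2 := sum_reflect_le (f := fun y : ℕ => (y : ℝ) ^ (-al))
            (fun _ => by positivity) (N := N) hu
          refine mul_le_mul_of_nonneg_left ?_ hc0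
          linarith
  calc _ ≤ ∑ a ∈ pairsEq r N u ∪ (pairsOut r N u).filter (fun a => a ≠ N + u - a),
        pairWt al r (N + u) a :=
        Finset.sum_le_sum_of_subset_of_nonneg hsub fun _ _ _ => pairWt_nonneg _ _
    _ ≤ ∑ a ∈ pairsEq r N u, pairWt al r (N + u) a +
        ∑ a ∈ (pairsOut r N u).filter (fun a => a ≠ N + u - a), pairWt al r (N + u) a := by
        rw [← Finset.sum_union_inter]
        exact le_add_of_nonneg_right (Finset.sum_nonneg fun _ _ => pairWt_nonneg _ _)
    _ ≤ c + c * (2 * ((1 - al)⁻¹ * (N : ℝ) ^ (1 - al))) :=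
        add_le_add (sum_pairsEq_le hal hN) hmain
    _ = 2 ^ al * (N : ℝ) ^ (-al) + 2 ^ al * (2 * (1 - al)⁻¹) *
          ((N : ℝ) ^ (-al) * (N : ℝ) ^ (1 - al)) := by rw [hc]; ring
    _ ≤ 2 ^ al * (N : ℝ) ^ (1 - 2 * al) + 2 ^ al * (2 * (1 - al)⁻¹) *
          (N : ℝ) ^ (1 - 2 * al) := by rw [hpow]; gcongr
    _ = _ := by unfold outConst; ring

lemma card_pairsIn_le (N u : ℕ) : (pairsIn r N u).card ≤ 2 * r.card := by
  have hsub : pairsIn r N u ⊆ r ∪ r.image fun b => N + u - b := by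
    intro a ha
    simp only [pairsIn, Finset.mem_filter, Finset.mem_Icc] at ha
    simp only [Finset.mem_union, Finset.mem_image]
    rcases ha.2 with h | h
    · exact Or.inl h
    · exact Or.inr ⟨_, h, by omega⟩
  calc _ ≤ _ := Finset.card_le_card hsub
    _ ≤ _ := Finset.card_union_le _ _
    _ ≤ r.card + r.card := Nat.add_le_add_left Finset.card_image_le _
    _ = _ := (two_mul _).symm

lemma sum_pairsIn_le (hal : 0 < al) (N u : ℕ) :
    ∑ a ∈ pairsIn r N u, pairWt al r (N + u) a ≤ 2 * r.card := by
  calc _ ≤ (pairsIn r N u).card • (1 : ℝ) :=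
        Finset.sum_le_card_nsmul _ _ _ fun _ _ => pairWt_le_one hal _ _
    _ ≤ _ := by
      rw [nsmul_one]; exact_mod_cast card_pairsIn_le N u

lemma sum_card_both_mem_le (N : ℕ) :
    ∑ u ∈ Finset.Icc 1 N, ((Finset.Icc u N).filter fun a => a ∈ r ∧ N + u - a ∈ r).card ≤
      r.card ^ 2 := by
  rw [← Finset.card_sigma, sq, ← Finset.card_product]
  refine Finset.card_le_card_of_injOn (fun p => (p.2, N + p.1 - p.2)) ?_ ?_
  · intro p hp
    simp only [Finset.coe_sigma, Set.mem_sigma_iff, Finset.mem_coe, Finset.mem_filter] at hp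
    simpa using hp.2.2
  · rintro ⟨u, a⟩ hp ⟨v, b⟩ hq h
    simp only [Finset.coe_sigma, Set.mem_sigma_iff, Finset.mem_coe, Finset.mem_filter,
      Finset.mem_Icc] at hp hq
    simp only [Prod.mk.injEq] at h
    obtain ⟨rfl, h⟩ := h
    obtain rfl : u = v := by omega
    rfl

/-- The constant in the bound for the sum over `u` of pairs meeting `r`. -/
def inConst (al K : ℝ) : ℝ := 3 * K ^ 2 + 2 * K * ∑' u : ℕ, (u : ℝ) ^ (-(2 * al))

lemma inConst_nonneg {K : ℝ} (hK : 0 ≤ K) : 0 ≤ inConst al K := by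
  have : 0 ≤ ∑' u : ℕ, (u : ℝ) ^ (-(2 * al)) := tsum_nonneg fun _ => by positivity
  unfold inConst; positivity

lemma sum_wt_mul_pairsIn_le (hal : 1 / 2 < al) {K : ℝ} (hK : (r.card : ℝ) ≤ K) (N : ℕ) :
    ∑ u ∈ Finset.Icc 1 N, wt al r u * ∑ a ∈ pairsIn r N u, pairWt al r (N + u) a ≤
      inConst al K := by
  have hal0 : 0 < al := by linarith
  have hK0 : 0 ≤ K := (Nat.cast_nonneg _).trans hK
  have hterm : ∀ u ∈ Finset.Icc 1 N,
      wt al r u * ∑ a ∈ pairsIn r N u, pairWt al r (N + u) a ≤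
        (if u ∈ r then 2 * K else 0) +
        (((Finset.Icc u N).filter fun a => a ∈ r ∧ N + u - a ∈ r).card : ℝ) +
        2 * K * (u : ℝ) ^ (-(2 * al)) := by
    intro u hu
    rw [Finset.mem_Icc] at hu
    have hu0 : (0 : ℝ) < u := by exact_mod_cast hu.1
    have hs0 : 0 ≤ ∑ a ∈ pairsIn r N u, pairWt al r (N + u) a :=
      Finset.sum_nonneg fun _ _ => pairWt_nonneg _ _
    have hsK := sum_pairsIn_le (r := r) hal0 N u
    have hX : 0 ≤ 2 * K * (u : ℝ) ^ (-(2 * al)) := by positivity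
    have hD := Nat.cast_nonneg (α := ℝ)
      ((Finset.Icc u N).filter fun a => a ∈ r ∧ N + u - a ∈ r).card
    by_cases hur : u ∈ r
    · rw [if_pos hur]
      have := mul_le_of_le_one_left hs0 (wt_le_one (r := r) hal0 u)
      linarith
    · rw [if_neg hur, wt_of_not_mem hur, zero_add]
      have hp1 : (u : ℝ) ^ (-al) ≤ 1 := by
        rw [← wt_of_not_mem hur]; exact wt_le_one hal0 u
      have hp0 : 0 ≤ (u : ℝ) ^ (-al) := by positivity
      have hpair : ∀ a ∈ pairsIn r N u, pairWt al r (N + u) a ≤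
          (if a ∈ r ∧ N + u - a ∈ r then (1 : ℝ) else 0) + (u : ℝ) ^ (-al) := by
        intro a ha
        simp only [pairsIn, Finset.mem_filter, Finset.mem_Icc] at ha
        obtain ⟨ha1, ha2⟩ := ha
        have hanti : ∀ y : ℕ, u ≤ y → (y : ℝ) ^ (-al) ≤ (u : ℝ) ^ (-al) := fun y hy =>
          Real.rpow_le_rpow_of_nonpos hu0 (by exact_mod_cast hy) (by linarith)
        split_ifs with hb
        · have := pairWt_le_one (r := r) hal0 (N + u) a
          linarith
        · rw [zero_add]
          by_cases har : a ∈ r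
          · have hb' : N + u - a ∉ r := fun h => hb ⟨har, h⟩
            refine (pairWt_le_of_mem hal0 (y := N + u - a) (by simp)).trans ?_
            rw [wt_of_not_mem hb']
            exact hanti _ (by omega)
          · refine (pairWt_le_of_mem hal0 (y := a) (by simp)).trans ?_
            rw [wt_of_not_mem har]
            exact hanti _ ha1.1
      have hsum : ∑ a ∈ pairsIn r N u, pairWt al r (N + u) a ≤
          (((Finset.Icc u N).filter fun a => a ∈ r ∧ N + u - a ∈ r).card : ℝ) +
            2 * K * (u : ℝ) ^ (-al) := by
        calc _ ≤ _ := Finset.sum_le_sum hpair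
          _ = (((pairsIn r N u).filter fun a => a ∈ r ∧ N + u - a ∈ r).card : ℝ) +
              (pairsIn r N u).card * (u : ℝ) ^ (-al) := by
            rw [Finset.sum_add_distrib, Finset.sum_boole, Finset.sum_const, nsmul_eq_mul]
          _ ≤ _ := by
            have hc : ((pairsIn r N u).card : ℝ) ≤ 2 * K := by
              have : ((pairsIn r N u).card : ℝ) ≤ 2 * r.card := by
                exact_mod_cast card_pairsIn_le N u
              linarith
            have hf : (pairsIn r N u).filter (fun a => a ∈ r ∧ N + u - a ∈ r) ⊆
                (Finset.Icc u N).filter fun a => a ∈ r ∧ N + u - a ∈ r :=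
              Finset.filter_subset_filter _ (Finset.filter_subset _ _)
            gcongr
      have hsq : (u : ℝ) ^ (-al) * (u : ℝ) ^ (-al) = (u : ℝ) ^ (-(2 * al)) := by
        rw [← Real.rpow_add hu0]; congr 1; ring
      calc _ ≤ (u : ℝ) ^ (-al) * _ := mul_le_mul_of_nonneg_left hsum hp0
        _ = (u : ℝ) ^ (-al) *
              (((Finset.Icc u N).filter fun a => a ∈ r ∧ N + u - a ∈ r).card : ℝ) +
            2 * K * ((u : ℝ) ^ (-al) * (u : ℝ) ^ (-al)) := by ring
        _ ≤ _ := by rw [hsq]; gcongr; exact mul_le_of_le_one_left hD hp1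
  refine (Finset.sum_le_sum hterm).trans ?_
  rw [Finset.sum_add_distrib, Finset.sum_add_distrib, ← Finset.mul_sum]
  have h1 : ∑ u ∈ Finset.Icc 1 N, (if u ∈ r then 2 * K else 0) ≤ 2 * K ^ 2 := by
    rw [← Finset.sum_filter, Finset.sum_const, nsmul_eq_mul]
    have : (((Finset.Icc 1 N).filter (· ∈ r)).card : ℝ) ≤ K := by
      refine le_trans ?_ hK
      exact_mod_cast Finset.card_le_card fun y hy => (Finset.mem_filter.1 hy).2
    nlinarith
  have h2 : ∑ u ∈ Finset.Icc 1 N,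
      (((Finset.Icc u N).filter fun a => a ∈ r ∧ N + u - a ∈ r).card : ℝ) ≤ K ^ 2 := by
    have : ∑ u ∈ Finset.Icc 1 N,
      (((Finset.Icc u N).filter fun a => a ∈ r ∧ N + u - a ∈ r).card : ℝ) ≤ (r.card : ℝ) ^ 2 := by
      exact_mod_cast sum_card_both_mem_le N
    exact this.trans (by gcongr)
  have h3 : ∑ u ∈ Finset.Icc 1 N, (u : ℝ) ^ (-(2 * al)) ≤ ∑' u : ℕ, (u : ℝ) ^ (-(2 * al)) :=
    Summable.sum_le_tsum _ (fun _ _ => by positivity)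
      (Real.summable_nat_rpow.2 (by linarith))
  have h4 := mul_le_mul_of_nonneg_left h3 (show 0 ≤ 2 * K by positivity)
  unfold inConst
  linarith

end Weights

section Tuples

variable {g M n : ℕ} {lam : ℝ} {s : ℕ → Fin 3 → ZMod M} {r : Finset ℕ}
  {x : Fin (2 * g + 4) → ℕ}

/-- The entry `x₁`. -/
def head (x : Fin (2 * g + 4) → ℕ) : ℕ := x ⟨0, by omega⟩

/-- The entry `x₄`. -/
def fourth (x : Fin (2 * g + 4) → ℕ) : ℕ := x ⟨3, by omega⟩

/-- The left entry of the `k`-th free pair. -/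
def pairLeft (x : Fin (2 * g + 4) → ℕ) (k : Fin g) : ℕ := x ⟨2 * ((k : ℕ) + 2), by omega⟩

/-- The right entry of the `k`-th free pair. -/
def pairRight (x : Fin (2 * g + 4) → ℕ) (k : Fin g) : ℕ := x ⟨2 * ((k : ℕ) + 2) + 1, by omega⟩

lemma index_cases (i : Fin (2 * g + 4)) (hi : 3 ≤ (i : ℕ)) :
    x i = fourth x ∨ ∃ k : Fin g, x i = pairLeft x k ∨ x i = pairRight x k := by
  by_cases h3 : (i : ℕ) = 3
  · left; unfold fourth; congr 1; exact Fin.ext h3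
  · right
    refine ⟨⟨((i : ℕ) - 4) / 2, by omega⟩, ?_⟩
    unfold pairLeft pairRight
    rcases Nat.even_or_odd' (i : ℕ) with ⟨c, hc | hc⟩
    · left; congr 1; apply Fin.ext; simp only; omega
    · right; congr 1; apply Fin.ext; simp only; omega

lemma exists_index {j : ℕ} (h2 : 2 ≤ j) (hj : j ≤ g + 1) :
    ∃ k : Fin g, x ⟨2 * j, by omega⟩ = pairLeft x k ∧ x ⟨2 * j + 1, by omega⟩ = pairRight x k := by
  obtain ⟨k, rfl⟩ := Nat.exists_eq_add_of_le' h2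
  exact ⟨⟨k, by omega⟩, rfl, rfl⟩

lemma pair_sum (hx : x ∈ Tn g M lam s n) (k : Fin g) :
    pairLeft x k + pairRight x k = head x + fourth x :=
  (hx.2.2.1 (k + 2) (by omega) (by omega)).symm

lemma pairRight_eq (hx : x ∈ Tn g M lam s n) (k : Fin g) :
    head x + fourth x - pairLeft x k = pairRight x k := by
  have := pair_sum hx k
  omega

lemma fourth_mem (hx : x ∈ Tn g M lam s n) : fourth x ∈ Finset.Icc 1 (head x) :=
  Finset.mem_Icc.2 ⟨hx.1 _, hx.2.2.2.1 ⟨3, by omega⟩ (by simp)⟩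

lemma pairLeft_mem (hx : x ∈ Tn g M lam s n) (k : Fin g) :
    pairLeft x k ∈ Finset.Icc (fourth x) (head x) := by
  have h1 : pairLeft x k ≤ head x := hx.2.2.2.1 _ (by simp only; omega)
  have h2 : pairRight x k ≤ head x := hx.2.2.2.1 _ (by simp only; omega)
  have := pair_sum hx k
  rw [Finset.mem_Icc]
  omega

lemma pairOf_zero : pairOf g x 0 = {head x, fourth x} := rfl

lemma pairOf_succ (k : Fin g) : pairOf g x (k + 1) = {pairLeft x k, pairRight x k} := by
  have h : (k : ℕ) + 1 ≤ g := k.isLt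
  rw [pairOf, if_neg (Nat.succ_ne_zero _), dif_pos h]
  rfl

lemma fourth_not_mem_pair (hx : x ∈ Tn g M lam s n) (k : Fin g) :
    fourth x ∉ ({pairLeft x k, pairRight x k} : Finset ℕ) := by
  intro h
  have hs := pair_sum hx k
  apply hx.2.2.2.2.2 0 (k + 1) (by omega) k.isLt (by omega)
  rw [pairOf_zero, pairOf_succ]
  simp only [Finset.mem_insert, Finset.mem_singleton] at h
  rcases h with h | h
  · have : head x = pairRight x k := by omega
    rw [h, this, Finset.pair_comm]
  · have : head x = pairLeft x k := by omega
    rw [h, this]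

lemma pairs_disjoint (hx : x ∈ Tn g M lam s n) {k l : Fin g} (hkl : k ≠ l) :
    Disjoint ({pairLeft x k, pairRight x k} : Finset ℕ) {pairLeft x l, pairRight x l} := by
  have hk := pair_sum hx k
  have hl := pair_sum hx l
  have hne := hx.2.2.2.2.2 (k + 1) (l + 1) k.isLt l.isLt
    (by simpa [Fin.ext_iff] using hkl)
  rw [pairOf_succ, pairOf_succ] at hne
  rw [Finset.disjoint_left]
  intro y hy hy'
  apply hne
  simp only [Finset.mem_insert, Finset.mem_singleton] at hy hy'
  by_cases h : pairLeft x k = pairLeft x l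
  · have : pairRight x k = pairRight x l := by omega
    rw [h, this]
  · have h1 : pairLeft x k = pairRight x l := by omega
    have h2 : pairRight x k = pairLeft x l := by omega
    rw [h1, h2, Finset.pair_comm]

lemma tuple_weight_le {al : ℝ} (hal : 0 < al) (hlam : 1 < lam) (hx : x ∈ Tn g M lam s n) :
    ∏ y ∈ imgF x \ r, lam⁻¹ * (y : ℝ) ^ (-al) ≤
      wt al r (fourth x) * ∏ k, pairWt al r (head x + fourth x) (pairLeft x k) := by
  set P : Fin g → Finset ℕ := fun k => {pairLeft x k, pairRight x k} with hP
  have hrhs : wt al r (fourth x) * ∏ k, pairWt al r (head x + fourth x) (pairLeft x k) =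
      ∏ y ∈ insert (fourth x) (Finset.univ.biUnion P), wt al r y := by
    rw [Finset.prod_insert, Finset.prod_biUnion]
    · simp only [pairWt, pairRight_eq hx, hP]
    · intro k _ l _ hkl
      exact pairs_disjoint hx hkl
    · simp only [Finset.mem_biUnion, Finset.mem_univ, true_and, not_exists]
      exact fun k => fourth_not_mem_pair hx k
  have hsub : insert (fourth x) (Finset.univ.biUnion P) ⊆ imgF x := by
    intro y hy
    simp only [Finset.mem_insert, Finset.mem_biUnion, Finset.mem_univ, true_and, hP,
      Finset.mem_singleton] at hy
    rcases hy with rfl | ⟨k, rfl | rfl⟩ <;> exact Finset.mem_image_of_mem _ (Finset.mem_univ _)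
  rw [hrhs]
  calc ∏ y ∈ imgF x \ r, lam⁻¹ * (y : ℝ) ^ (-al)
      ≤ ∏ y ∈ imgF x \ r, wt al r y := by
        refine Finset.prod_le_prod (fun y _ => by positivity) fun y hy => ?_
        rw [wt_of_not_mem (Finset.mem_sdiff.1 hy).2]
        exact mul_le_of_le_one_left (by positivity) (inv_le_one_of_one_le₀ hlam.le)
    _ = ∏ y ∈ imgF x, wt al r y := by
        refine Finset.prod_subset Finset.sdiff_subset fun y hy hy' => ?_
        have : y ∈ r := by simpa [hy] using hy'
        exact if_pos this
    _ ≤ _ := by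
        rw [← Finset.prod_sdiff hsub]
        exact mul_le_of_le_one_left (Finset.prod_nonneg fun y _ => wt_nonneg y)
          (Finset.prod_le_one (fun y _ => wt_nonneg y) fun y _ => wt_le_one hal y)

lemma tuple_ext {x' : Fin (2 * g + 4) → ℕ} (hx : x ∈ Tn g M lam s n) (hx' : x' ∈ Tn g M lam s n)
    (h0 : head x = head x') (h1 : x ⟨1, by omega⟩ = x' ⟨1, by omega⟩)
    (h2 : x ⟨2, by omega⟩ = x' ⟨2, by omega⟩) (h3 : fourth x = fourth x')
    (hp : pairLeft x = pairLeft x') : x = x' := by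
  have hr : ∀ k, pairRight x k = pairRight x' k := fun k => by
    rw [← pairRight_eq hx, ← pairRight_eq hx', h0, h3, hp]
  funext ⟨i, hi⟩
  rcases Nat.lt_or_ge i 4 with h | h
  · interval_cases i
    exacts [h0, h1, h2, h3]
  · rcases Nat.even_or_odd' i with ⟨c, rfl | rfl⟩
    · obtain ⟨k, rfl⟩ := Nat.exists_eq_add_of_le' (show 2 ≤ c by omega)
      exact congrFun hp ⟨k, by omega⟩
    · obtain ⟨k, rfl⟩ := Nat.exists_eq_add_of_le' (show 2 ≤ c by omega)
      exact hr ⟨k, by omega⟩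

/-- The sum over tuples whose entries are confined to prescribed ranges factors over the pairs. -/
lemma sum_tuples_le {al : ℝ} (hal : 0 < al) (hlam : 1 < lam)
    (S : Finset (Fin (2 * g + 4) → ℕ)) (R : Finset ℕ) (U : ℕ → Finset ℕ)
    (A : ℕ → ℕ → Fin g → Finset ℕ) (hS : ∀ x ∈ S, x ∈ T3 g M lam s n r ∧ head x ∈ R)
    (hU : ∀ x ∈ S, fourth x ∈ U (head x) ∧
      ∀ k, pairLeft x k ∈ A (head x) (fourth x) k) :
    ∑ x ∈ S, ∏ y ∈ imgF x \ r, lam⁻¹ * (y : ℝ) ^ (-al) ≤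
      (r.card : ℝ) ^ 2 * ∑ N ∈ R, ∑ u ∈ U N, wt al r u *
        ∏ k, ∑ a ∈ A N u k, pairWt al r (N + u) a := by
  classical
  let I : Finset (Σ _ : ℕ × ℕ, Σ _ : ℕ, Σ _ : ℕ, Fin g → ℕ) :=
    (r ×ˢ r).sigma fun _ => R.sigma fun N => (U N).sigma fun u => Fintype.piFinset (A N u)
  let e : (Fin (2 * g + 4) → ℕ) → (Σ _ : ℕ × ℕ, Σ _ : ℕ, Σ _ : ℕ, Fin g → ℕ) :=
    fun x => ⟨(x ⟨1, by omega⟩, x ⟨2, by omega⟩), head x, fourth x, pairLeft x⟩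
  let V : (Σ _ : ℕ × ℕ, Σ _ : ℕ, Σ _ : ℕ, Fin g → ℕ) → ℝ := fun p =>
    wt al r p.2.2.1 * ∏ k, pairWt al r (p.2.1 + p.2.2.1) (p.2.2.2 k)
  have hV : ∀ p, 0 ≤ V p := fun p =>
    mul_nonneg (wt_nonneg _) (Finset.prod_nonneg fun _ _ => pairWt_nonneg _ _)
  have hinj : Set.InjOn e S := by
    intro x hx x' hx' h
    simp only [e, Sigma.mk.injEq, Prod.mk.injEq, heq_eq_eq] at h
    obtain ⟨⟨h1, h2⟩, h0, h3, hp⟩ := h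
    exact tuple_ext (hS x hx).1.1 (hS x' hx').1.1 h0 h1 h2 h3 hp
  calc _ ≤ ∑ x ∈ S, V (e x) :=
        Finset.sum_le_sum fun x hx => tuple_weight_le hal hlam (hS x hx).1.1
    _ = ∑ p ∈ S.image e, V p := (Finset.sum_image hinj).symm
    _ ≤ ∑ p ∈ I, V p := by
        refine Finset.sum_le_sum_of_subset_of_nonneg ?_ fun p _ _ => hV p
        intro p hp
        obtain ⟨x, hx, rfl⟩ := Finset.mem_image.1 hp
        simp only [I, e, Finset.mem_sigma, Finset.mem_product, Fintype.mem_piFinset]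
        exact ⟨⟨(hS x hx).1.2.2.1, (hS x hx).1.2.2.2.1⟩, (hS x hx).2, hU x hx⟩
    _ = _ := by
        simp only [I, V, Finset.sum_sigma, Finset.sum_const, Finset.card_product, nsmul_eq_mul]
        rw [Nat.cast_mul, ← sq]
        congr 1
        refine Finset.sum_congr rfl fun N _ => Finset.sum_congr rfl fun u _ => ?_
        rw [Finset.prod_univ_sum, Finset.mul_sum]

lemma sum_tuples_le_of_cover {ι : Type*} [Fintype ι] {al : ℝ} (hal : 0 < al) (hlam : 1 < lam)
    (S : Finset (Fin (2 * g + 4) → ℕ)) (R : Finset ℕ) (hR : R ⊆ r) (U : ι → ℕ → Finset ℕ)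
    (A : ι → ℕ → ℕ → Fin g → Finset ℕ) (hS : ∀ x ∈ S, x ∈ T3 g M lam s n r ∧ head x ∈ R)
    (hU : ∀ x ∈ S, ∃ c, fourth x ∈ U c (head x) ∧
      ∀ k, pairLeft x k ∈ A c (head x) (fourth x) k)
    {B K : ℝ} (hB0 : 0 ≤ B) (hK : (r.card : ℝ) ≤ K)
    (hB : ∀ c, ∀ N ∈ R, ∑ u ∈ U c N, wt al r u *
        ∏ k, ∑ a ∈ A c N u k, pairWt al r (N + u) a ≤ B) :
    ∑ x ∈ S, ∏ y ∈ imgF x \ r, lam⁻¹ * (y : ℝ) ^ (-al) ≤ Fintype.card ι * (K ^ 3 * B) := by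
  classical
  have hw : ∀ x : Fin (2 * g + 4) → ℕ, 0 ≤ ∏ y ∈ imgF x \ r, lam⁻¹ * (y : ℝ) ^ (-al) :=
    fun x => Finset.prod_nonneg fun y _ => by
      have : 0 < lam := by linarith
      positivity
  have hK0 : (0 : ℝ) ≤ r.card := Nat.cast_nonneg _
  let Q : ι → Finset (Fin (2 * g + 4) → ℕ) := fun c =>
    S.filter fun x => fourth x ∈ U c (head x) ∧ ∀ k, pairLeft x k ∈ A c (head x) (fourth x) k
  have hclass : ∀ c, ∑ x ∈ Q c, ∏ y ∈ imgF x \ r, lam⁻¹ * (y : ℝ) ^ (-al) ≤ K ^ 3 * B := by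
    intro c
    calc _ ≤ (r.card : ℝ) ^ 2 * ∑ N ∈ R, ∑ u ∈ U c N, wt al r u *
          ∏ k, ∑ a ∈ A c N u k, pairWt al r (N + u) a :=
          sum_tuples_le hal hlam (Q c) R (U c) (A c)
            (fun x hx => hS x (Finset.mem_filter.1 hx).1) fun x hx => (Finset.mem_filter.1 hx).2
      _ ≤ (r.card : ℝ) ^ 2 * (R.card • B) := by
          gcongr
          exact Finset.sum_le_card_nsmul _ _ _ (hB c)
      _ ≤ K ^ 2 * (K * B) := by
          rw [nsmul_eq_mul]
          have : (R.card : ℝ) ≤ K := le_trans (by exact_mod_cast Finset.card_le_card hR) hK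
          gcongr
      _ = K ^ 3 * B := by ring
  calc _ ≤ ∑ x ∈ S, ∑ c, if x ∈ Q c then ∏ y ∈ imgF x \ r, lam⁻¹ * (y : ℝ) ^ (-al) else 0 := by
        refine Finset.sum_le_sum fun x hx => ?_
        obtain ⟨c, hc⟩ := hU x hx
        have hxc : x ∈ Q c := Finset.mem_filter.2 ⟨hx, hc⟩
        refine le_trans (by rw [if_pos hxc]) (Finset.single_le_sum (f := fun c =>
          if x ∈ Q c then ∏ y ∈ imgF x \ r, lam⁻¹ * (y : ℝ) ^ (-al) else 0)
          (fun c _ => ?_) (Finset.mem_univ c))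
        split_ifs
        exacts [hw x, le_rfl]
    _ = ∑ c, ∑ x ∈ Q c, ∏ y ∈ imgF x \ r, lam⁻¹ * (y : ℝ) ^ (-al) := by
        rw [Finset.sum_comm]
        refine Finset.sum_congr rfl fun c _ => ?_
        rw [← Finset.sum_filter, Finset.filter_mem_eq_inter,
          Finset.inter_eq_right.2 (Finset.filter_subset _ _)]
    _ ≤ ∑ _c : ι, K ^ 3 * B := Finset.sum_le_sum fun c _ => hclass c
    _ = _ := by rw [Finset.sum_const, nsmul_eq_mul, Finset.card_univ]

end Tuples

section RangeBounds

variable {g : ℕ} {al K : ℝ} {r : Finset ℕ} {N : ℕ}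

lemma prod_le_mul_pow {S : Fin g → ℝ} {B : ℝ} (h0 : ∀ k, 0 ≤ S k) (hB : ∀ k, S k ≤ B)
    (hB1 : 1 ≤ B) (j : Fin g) : ∏ k, S k ≤ S j * B ^ g := by
  rw [← Finset.mul_prod_erase _ _ (Finset.mem_univ j)]
  refine mul_le_mul_of_nonneg_left ?_ (h0 j)
  calc _ ≤ ∏ _k ∈ Finset.univ.erase j, B :=
        Finset.prod_le_prod (fun k _ => h0 k) fun k _ => hB k
    _ = B ^ (Finset.univ.erase j).card := Finset.prod_const _
    _ ≤ B ^ g := pow_le_pow_right₀ hB1 (by simp)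

lemma prod_le_mul_mul_pow {S : Fin g → ℝ} {B : ℝ} (h0 : ∀ k, 0 ≤ S k) (hB : ∀ k, S k ≤ B)
    (hB1 : 1 ≤ B) {i j : Fin g} (hij : i ≠ j) : ∏ k, S k ≤ S i * S j * B ^ g := by
  rw [← Finset.mul_prod_erase _ _ (Finset.mem_univ i),
    ← Finset.mul_prod_erase _ _ (Finset.mem_erase.2 ⟨hij.symm, Finset.mem_univ j⟩), mul_assoc]
  refine mul_le_mul_of_nonneg_left (mul_le_mul_of_nonneg_left ?_ (h0 j)) (h0 i)
  calc _ ≤ ∏ _k ∈ (Finset.univ.erase i).erase j, B :=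
        Finset.prod_le_prod (fun k _ => h0 k) fun k _ => hB k
    _ = B ^ ((Finset.univ.erase i).erase j).card := Finset.prod_const _
    _ ≤ B ^ g := pow_le_pow_right₀ hB1 ((Finset.card_le_univ _).trans (by simp))

lemma prod_eq_mul_pow_le {S : Fin g → ℝ} {b c : ℝ} (h0 : ∀ k, 0 ≤ S k) (j : Fin g)
    (hc : S j ≤ c) (hb : ∀ k, k ≠ j → S k ≤ b) : ∏ k, S k ≤ c * b ^ (g - 1) := by
  rw [← Finset.mul_prod_erase _ _ (Finset.mem_univ j)]
  have h : ∏ k ∈ Finset.univ.erase j, S k ≤ b ^ (g - 1) := by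
    calc _ ≤ ∏ _k ∈ Finset.univ.erase j, b :=
          Finset.prod_le_prod (fun k _ => h0 k) fun k hk => hb k (Finset.ne_of_mem_erase hk)
      _ = b ^ (g - 1) := by rw [Finset.prod_const]; simp
  exact mul_le_mul hc h (Finset.prod_nonneg fun k _ => h0 k) ((h0 j).trans hc)

lemma sum_pairWt_nonneg (A : Finset ℕ) (m : ℕ) : 0 ≤ ∑ a ∈ A, pairWt al r m a :=
  Finset.sum_nonneg fun _ _ => pairWt_nonneg _ _

/-- A bound for the total weight of all pairs with a given sum. -/
def allConst (al K : ℝ) : ℝ := 2 * K + outConst al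

lemma sum_pairWt_le_allConst (hal : 1 / 2 < al) (hal1 : al < 1) (hK : (r.card : ℝ) ≤ K)
    {u : ℕ} (hN : 1 ≤ N) (hu : 1 ≤ u) {A : Finset ℕ} (hA : A ⊆ Finset.Icc u N) :
    ∑ a ∈ A, pairWt al r (N + u) a ≤ allConst al K := by
  have hN1 : (1 : ℝ) ≤ N := by exact_mod_cast hN
  have hsub : A ⊆ pairsIn r N u ∪ pairsOut r N u := by
    intro a ha
    have := hA ha
    simp only [pairsIn, pairsOut, Finset.mem_union, Finset.mem_filter]
    tauto
  have h1 := sum_pairsIn_le (r := r) (al := al) (by linarith) N u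
  have h2 := sum_pairsOut_le (r := r) (al := al) (by linarith) hal1 hN hu
  have h3 : outConst al * (N : ℝ) ^ (1 - 2 * al) ≤ outConst al :=
    mul_le_of_le_one_right (outConst_nonneg hal1)
      (Real.rpow_le_one_of_one_le_of_nonpos hN1 (by linarith))
  calc _ ≤ ∑ a ∈ pairsIn r N u ∪ pairsOut r N u, pairWt al r (N + u) a :=
        Finset.sum_le_sum_of_subset_of_nonneg hsub fun _ _ _ => pairWt_nonneg _ _
    _ ≤ ∑ a ∈ pairsIn r N u, pairWt al r (N + u) a +
        ∑ a ∈ pairsOut r N u, pairWt al r (N + u) a := by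
        rw [← Finset.sum_union_inter]
        exact le_add_of_nonneg_right (sum_pairWt_nonneg _ _)
    _ ≤ _ := by unfold allConst; linarith

lemma one_le_allConst (hal1 : al < 1) (hK1 : 1 ≤ K) : 1 ≤ allConst al K := by
  have := outConst_nonneg hal1
  unfold allConst; linarith

lemma sum_wt_sdiff_le (hal : 0 < al) (hal1 : al < 1) :
    ∑ u ∈ Finset.Icc 1 N \ r, wt al r u ≤ (1 - al)⁻¹ * (N : ℝ) ^ (1 - al) := by
  calc _ = ∑ u ∈ Finset.Icc 1 N \ r, (u : ℝ) ^ (-al) :=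
        Finset.sum_congr rfl fun u hu => wt_of_not_mem (Finset.mem_sdiff.1 hu).2
    _ ≤ ∑ u ∈ Finset.Icc 1 N, (u : ℝ) ^ (-al) :=
        Finset.sum_le_sum_of_subset_of_nonneg Finset.sdiff_subset fun _ _ _ => by positivity
    _ ≤ _ := sum_Icc_rpow_neg_le hal hal1 N

lemma sum_all_out_le (hal : 1 / 2 < al) (hal1 : al < 1) (hkey : 1 - al = g * (2 * al - 1))
    (hN : 1 ≤ N) :
    ∑ u ∈ Finset.Icc 1 N \ r, wt al r u *
      ∏ _k : Fin g, ∑ a ∈ pairsOut r N u, pairWt al r (N + u) a ≤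
      outConst al ^ g * (1 - al)⁻¹ := by
  have hN0 : (0 : ℝ) < N := by exact_mod_cast hN
  have hD := outConst_nonneg hal1
  calc _ ≤ ∑ u ∈ Finset.Icc 1 N \ r, wt al r u * (outConst al * (N : ℝ) ^ (1 - 2 * al)) ^ g := by
        refine Finset.sum_le_sum fun u hu => mul_le_mul_of_nonneg_left ?_ (wt_nonneg u)
        rw [Finset.prod_const, Finset.card_univ, Fintype.card_fin]
        exact pow_le_pow_left₀ (sum_pairWt_nonneg _ _) (sum_pairsOut_le (by linarith) hal1 hN
          (Finset.mem_Icc.1 (Finset.mem_sdiff.1 hu).1).1) g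
    _ ≤ (1 - al)⁻¹ * (N : ℝ) ^ (1 - al) * (outConst al * (N : ℝ) ^ (1 - 2 * al)) ^ g := by
        rw [← Finset.sum_mul]
        exact mul_le_mul_of_nonneg_right (sum_wt_sdiff_le (by linarith) hal1) (by positivity)
    _ = outConst al ^ g * (1 - al)⁻¹ *
          ((N : ℝ) ^ (1 - al) * (N : ℝ) ^ ((1 - 2 * al) * g)) := by
        rw [mul_pow, ← Real.rpow_mul_natCast hN0.le]; ring
    _ = _ := by
        rw [← Real.rpow_add hN0, show 1 - al + (1 - 2 * al) * g = 0 by rw [hkey]; ring,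
          Real.rpow_zero, mul_one]

lemma sum_all_in_le (hg : 2 ≤ g) (hal : 1 / 2 < al) (hal1 : al < 1) (hK : (r.card : ℝ) ≤ K)
    (hK1 : 1 ≤ K) (hN : 1 ≤ N) :
    ∑ u ∈ Finset.Icc 1 N, wt al r u *
      ∏ _k : Fin g, ∑ a ∈ pairsIn r N u, pairWt al r (N + u) a ≤
      inConst al K * allConst al K ^ g := by
  have hB := one_le_allConst hal1 hK1
  calc _ ≤ ∑ u ∈ Finset.Icc 1 N, wt al r u *
        (∑ a ∈ pairsIn r N u, pairWt al r (N + u) a) * allConst al K ^ g := by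
        refine Finset.sum_le_sum fun u hu => ?_
        rw [mul_assoc]
        refine mul_le_mul_of_nonneg_left ?_ (wt_nonneg u)
        exact prod_le_mul_pow (fun _ => sum_pairWt_nonneg _ _)
          (fun _ => sum_pairWt_le_allConst hal hal1 hK hN (Finset.mem_Icc.1 hu).1
            (Finset.filter_subset _ _)) hB ⟨0, by omega⟩
    _ ≤ _ := by
        rw [← Finset.sum_mul]
        exact mul_le_mul_of_nonneg_right (sum_wt_mul_pairsIn_le hal hK N) (by positivity)

lemma sum_mem_out_le (hal : 1 / 2 < al) (hal1 : al < 1) (hK : (r.card : ℝ) ≤ K)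
    (hK1 : 1 ≤ K) (hN : 1 ≤ N) (j : Fin g) :
    ∑ u ∈ (Finset.Icc 1 N).filter (· ∈ r), wt al r u *
      ∏ k, ∑ a ∈ (if k = j then pairsOut r N u else Finset.Icc u N), pairWt al r (N + u) a ≤
      K * outConst al * allConst al K ^ g * (N : ℝ) ^ (1 - 2 * al) := by
  have hB := one_le_allConst hal1 hK1
  have hD := outConst_nonneg hal1
  have hterm : ∀ u ∈ (Finset.Icc 1 N).filter (· ∈ r), wt al r u *
      ∏ k, ∑ a ∈ (if k = j then pairsOut r N u else Finset.Icc u N), pairWt al r (N + u) a ≤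
      outConst al * (N : ℝ) ^ (1 - 2 * al) * allConst al K ^ g := by
    intro u hu
    have hu1 : 1 ≤ u := (Finset.mem_Icc.1 (Finset.mem_filter.1 hu).1).1
    refine (mul_le_of_le_one_left (Finset.prod_nonneg fun _ _ => sum_pairWt_nonneg _ _)
      (wt_le_one (by linarith) u)).trans ?_
    refine (prod_le_mul_pow (fun _ => sum_pairWt_nonneg _ _) (fun k =>
      sum_pairWt_le_allConst hal hal1 hK hN hu1 ?_) hB j).trans ?_
    · split_ifs
      exacts [Finset.filter_subset _ _, subset_rfl]
    · rw [if_pos rfl]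
      exact mul_le_mul_of_nonneg_right (sum_pairsOut_le (by linarith) hal1 hN hu1) (by positivity)
  have hcard : (((Finset.Icc 1 N).filter (· ∈ r)).card : ℝ) ≤ K := by
    refine le_trans ?_ hK
    exact_mod_cast Finset.card_le_card fun y hy => (Finset.mem_filter.1 hy).2
  calc _ ≤ _ := Finset.sum_le_card_nsmul _ _ _ hterm
    _ ≤ K * (outConst al * (N : ℝ) ^ (1 - 2 * al) * allConst al K ^ g) := by
        rw [nsmul_eq_mul]
        exact mul_le_mul_of_nonneg_right hcard (by positivity)
    _ = _ := by ring

lemma sum_in_out_le (hal : 1 / 2 < al) (hal1 : al < 1) (hK : (r.card : ℝ) ≤ K)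
    (hK1 : 1 ≤ K) (hN : 1 ≤ N) {i j : Fin g} (hij : i ≠ j) :
    ∑ u ∈ Finset.Icc 1 N, wt al r u *
      ∏ k, ∑ a ∈ (if k = i then pairsIn r N u else if k = j then pairsOut r N u
        else Finset.Icc u N), pairWt al r (N + u) a ≤
      inConst al K * outConst al * allConst al K ^ g * (N : ℝ) ^ (1 - 2 * al) := by
  have hB := one_le_allConst hal1 hK1
  have hD := outConst_nonneg hal1
  calc _ ≤ ∑ u ∈ Finset.Icc 1 N, wt al r u * (∑ a ∈ pairsIn r N u, pairWt al r (N + u) a) *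
        (outConst al * (N : ℝ) ^ (1 - 2 * al) * allConst al K ^ g) := by
        refine Finset.sum_le_sum fun u hu => ?_
        have hu1 : 1 ≤ u := (Finset.mem_Icc.1 hu).1
        rw [mul_assoc]
        refine mul_le_mul_of_nonneg_left ?_ (wt_nonneg u)
        refine (prod_le_mul_mul_pow (fun _ => sum_pairWt_nonneg _ _) (fun k =>
          sum_pairWt_le_allConst hal hal1 hK hN hu1 ?_) hB hij).trans ?_
        · split_ifs
          exacts [Finset.filter_subset _ _, Finset.filter_subset _ _, subset_rfl]
        · rw [if_pos rfl, if_neg hij.symm, if_pos rfl, mul_assoc]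
          refine mul_le_mul_of_nonneg_left ?_ (sum_pairWt_nonneg _ _)
          exact mul_le_mul_of_nonneg_right (sum_pairsOut_le (by linarith) hal1 hN hu1)
            (by positivity)
    _ ≤ inConst al K * (outConst al * (N : ℝ) ^ (1 - 2 * al) * allConst al K ^ g) := by
        rw [← Finset.sum_mul]
        exact mul_le_mul_of_nonneg_right (sum_wt_mul_pairsIn_le hal hK N) (by positivity)
    _ = _ := by ring

lemma sum_eq_out_le (hg : 2 ≤ g) (hal : 1 / 2 < al) (hal1 : al < 1) (hN : 1 ≤ N) (j : Fin g) :
    ∑ u ∈ Finset.Icc 1 N \ r, wt al r u *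
      ∏ k, ∑ a ∈ (if k = j then pairsEq r N u else pairsOut r N u), pairWt al r (N + u) a ≤
      (1 - al)⁻¹ * 2 ^ al * outConst al ^ (g - 1) * (N : ℝ) ^ (1 - 2 * al) := by
  have hN0 : (0 : ℝ) < N := by exact_mod_cast hN
  have hN1 : (1 : ℝ) ≤ N := by exact_mod_cast hN
  have hD := outConst_nonneg hal1
  have h1 : 0 < 1 - al := by linarith
  calc _ ≤ ∑ u ∈ Finset.Icc 1 N \ r, wt al r u *
        (2 ^ al * (N : ℝ) ^ (-al) * (outConst al * (N : ℝ) ^ (1 - 2 * al)) ^ (g - 1)) := by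
        refine Finset.sum_le_sum fun u hu => mul_le_mul_of_nonneg_left ?_ (wt_nonneg u)
        refine prod_eq_mul_pow_le (fun _ => sum_pairWt_nonneg _ _) j ?_ fun k hk => ?_
        · rw [if_pos rfl]
          exact sum_pairsEq_le (by linarith) hN
        · rw [if_neg hk]
          exact sum_pairsOut_le (by linarith) hal1 hN
            (Finset.mem_Icc.1 (Finset.mem_sdiff.1 hu).1).1
    _ ≤ (1 - al)⁻¹ * (N : ℝ) ^ (1 - al) *
        (2 ^ al * (N : ℝ) ^ (-al) * (outConst al * (N : ℝ) ^ (1 - 2 * al)) ^ (g - 1)) := by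
        rw [← Finset.sum_mul]
        exact mul_le_mul_of_nonneg_right (sum_wt_sdiff_le (by linarith) hal1) (by positivity)
    _ = (1 - al)⁻¹ * 2 ^ al * outConst al ^ (g - 1) *
          ((N : ℝ) ^ (1 - al) * (N : ℝ) ^ (-al) * (N : ℝ) ^ ((1 - 2 * al) * (g - 1 : ℕ))) := by
        rw [mul_pow, ← Real.rpow_mul_natCast hN0.le]; ring
    _ ≤ _ := by
        refine mul_le_mul_of_nonneg_left ?_ (by positivity)
        rw [← Real.rpow_add hN0, ← Real.rpow_add hN0]
        refine Real.rpow_le_rpow_of_exponent_le hN1 ?_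
        have hg1 : (1 : ℝ) ≤ (g - 1 : ℕ) := by exact_mod_cast (show 1 ≤ g - 1 by omega)
        nlinarith

end RangeBounds

section Main

variable {g M n : ℕ} {lam : ℝ} {s : ℕ → Fin 3 → ZMod M} {r : Finset ℕ}
  {x : Fin (2 * g + 4) → ℕ}

lemma half_lt_alph : 1 / 2 < alph g := by
  unfold alph
  rw [div_lt_div_iff₀ (by norm_num) (by positivity)]
  linarith

lemma alph_lt_one (hg : 2 ≤ g) : alph g < 1 := by
  have : (2 : ℝ) ≤ g := by exact_mod_cast hg
  unfold alph
  rw [div_lt_one (by positivity)]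
  linarith

lemma one_sub_alph : 1 - alph g = g * (2 * alph g - 1) := by
  unfold alph
  have : 2 * (g : ℝ) + 1 ≠ 0 := by positivity
  field_simp
  ring

lemma head_lower_bound (hg : 2 ≤ g) (hlam : 1 < lam) (hn : 3 ≤ n) (hx : x ∈ Tn g M lam s n) :
    (n : ℝ) ^ ((1 : ℝ) / g) / 4 ≤ head x := by
  have hn3 : (3 : ℝ) ≤ n := by exact_mod_cast hn
  have hg2 : (2 : ℝ) ≤ g := by exact_mod_cast hg
  have hpos : 0 ≤ (n : ℝ) ^ ((1 : ℝ) / g) := by positivity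
  have hlog : 1 ≤ Real.log n := by
    rw [Real.le_log_iff_exp_le (by linarith)]
    linarith [Real.exp_one_lt_d9]
  have h1 : 0 < 1 - alph g := by linarith [alph_lt_one hg]
  have hglam : (n : ℝ) ^ ((1 : ℝ) / g) ≤ glam g lam n := by
    have ha : 1 ≤ lam ^ ((2 * (g : ℝ) + 5) / (1 - alph g)) :=
      Real.one_le_rpow hlam.le (by positivity)
    have hb : 1 ≤ Real.log n ^ ((1 : ℝ) / (1 - alph g)) := Real.one_le_rpow hlog (by positivity)
    unfold glam
    exact (le_mul_of_one_le_left hpos ha).trans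
      (le_mul_of_one_le_right (mul_nonneg (by linarith) hpos) hb)
  have hle : (n : ℝ) ^ ((1 : ℝ) / g) ≤ n := by
    conv_rhs => rw [← Real.rpow_one (n : ℝ)]
    refine Real.rpow_le_rpow_of_exponent_le (by linarith) ?_
    rw [div_le_one (by linarith)]
    linarith
  obtain ⟨a, b, c, habc, hR⟩ := hx.2.1
  have hmem : head x ∈ ({a, b, c} : Finset ℕ) := by
    rw [← habc]; exact Finset.mem_insert_self _ _
  obtain ⟨-, -, -, -, ha, -, hb, -, hc, -⟩ := hR
  simp only [Finset.mem_insert, Finset.mem_singleton] at hmem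
  rcases hmem with h | h | h <;> rw [h] <;> linarith

lemma T3_finite (hr : ∀ a ∈ r, 1 ≤ a ∧ a ≤ n) : (T3 g M lam s n r).Finite := by
  refine (Set.finite_Iic fun _ => n).subset fun x hx i => ?_
  have h0 : head x ≤ n := (hr _ hx.2.1).2
  rcases Nat.lt_or_ge i 3 with h | h
  · obtain ⟨i, hi⟩ := i
    interval_cases i
    exacts [h0, (hr _ hx.2.2.1).2, (hr _ hx.2.2.2.1).2]
  · exact (hx.1.2.2.2.1 i h).trans h0

lemma tsum_subset_eq_sum {T : Set (Fin (2 * g + 4) → ℕ)} (hT : T.Finite)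
    (f : (Fin (2 * g + 4) → ℕ) → ℝ) : ∑' x : T, f x.1 = ∑ x ∈ hT.toFinset, f x := by
  have := Finset.tsum_subtype' hT.toFinset f
  rwa [hT.coe_toFinset] at this

lemma mem_pairsOut_iff (hx : x ∈ Tn g M lam s n) (k : Fin g) :
    pairLeft x k ∈ pairsOut r (head x) (fourth x) ↔ pairLeft x k ∉ r ∧ pairRight x k ∉ r := by
  rw [pairsOut, Finset.mem_filter, pairRight_eq hx]
  exact and_iff_right (pairLeft_mem hx k)

lemma mem_pairsIn_iff (hx : x ∈ Tn g M lam s n) (k : Fin g) :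
    pairLeft x k ∈ pairsIn r (head x) (fourth x) ↔ pairLeft x k ∈ r ∨ pairRight x k ∈ r := by
  rw [pairsIn, Finset.mem_filter, pairRight_eq hx]
  exact and_iff_right (pairLeft_mem hx k)

lemma mem_T4'_of_pair (hx : x ∈ T3 g M lam s n r) {i : Fin (2 * g + 4)} (hi : 3 ≤ (i : ℕ))
    (hir : x i ∈ r) (k : Fin g) (hl : pairLeft x k ∉ r) (hk : pairRight x k ∉ r) :
    x ∈ T4' g M lam s n r :=
  ⟨hx, ⟨i, hi, hir⟩, k + 2, by omega, by omega, hl, hk⟩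

lemma T4'_cases (hx : x ∈ T4' g M lam s n r) :
    ∃ j : Fin g, (pairLeft x j ∉ r ∧ pairRight x j ∉ r) ∧
      (fourth x ∈ r ∨ ∃ i, i ≠ j ∧ (pairLeft x i ∈ r ∨ pairRight x i ∈ r)) := by
  obtain ⟨-, ⟨i, hi, hir⟩, j, hj2, hjg, hl, hk⟩ := hx
  obtain ⟨j', h1, h2⟩ := exists_index (x := x) hj2 hjg
  rw [h1] at hl
  rw [h2] at hk
  refine ⟨j', ⟨hl, hk⟩, ?_⟩
  rcases index_cases (x := x) i hi with h | ⟨k, h⟩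
  · left; rwa [← h]
  · right
    have hmem : pairLeft x k ∈ r ∨ pairRight x k ∈ r := by
      rcases h with h | h <;> rw [h] at hir
      exacts [Or.inl hir, Or.inr hir]
    refine ⟨k, ?_, hmem⟩
    rintro rfl
    exact hmem.elim hl hk

lemma T5_cases (hx : x ∈ T5 g M lam s n r) :
    (fourth x ∉ r ∧ ∀ k, pairLeft x k ∉ r ∧ pairRight x k ∉ r) ∨
      ∀ k, pairLeft x k ∈ r ∨ pairRight x k ∈ r := by
  obtain ⟨hx3, hx4⟩ := hx
  by_contra! h
  obtain ⟨h1, k, hl, hk⟩ := h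
  have hno : ∀ i : Fin (2 * g + 4), 3 ≤ (i : ℕ) → x i ∉ r := fun i hi hir =>
    hx4 (Or.inl (mem_T4'_of_pair hx3 hi hir k hl hk))
  obtain ⟨l, hl'⟩ := h1 (hno ⟨3, by omega⟩ le_rfl)
  exact hno _ (by simp only; omega) (hl' (hno _ (by simp only; omega)))

lemma T4_cases (hx : x ∈ T4 g M lam s n r) :
    (∃ j : Fin g, fourth x ∈ r ∧ pairLeft x j ∉ r ∧ pairRight x j ∉ r) ∨
    (∃ i j : Fin g, i ≠ j ∧ (pairLeft x i ∈ r ∨ pairRight x i ∈ r) ∧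
      pairLeft x j ∉ r ∧ pairRight x j ∉ r) ∨
    ∃ j : Fin g, fourth x ∉ r ∧ pairLeft x j = pairRight x j ∧
      ∀ k, pairLeft x k ∉ r ∧ pairRight x k ∉ r := by
  have key : x ∈ T4' g M lam s n r →
      (∃ j : Fin g, fourth x ∈ r ∧ pairLeft x j ∉ r ∧ pairRight x j ∉ r) ∨
      (∃ i j : Fin g, i ≠ j ∧ (pairLeft x i ∈ r ∨ pairRight x i ∈ r) ∧
      pairLeft x j ∉ r ∧ pairRight x j ∉ r) := by
    intro h
    obtain ⟨j, hj, h | ⟨i, hij, hi⟩⟩ := T4'_cases h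
    exacts [Or.inl ⟨j, h, hj⟩, Or.inr ⟨i, j, hij, hi, hj⟩]
  rw [← or_assoc]
  by_cases h' : x ∈ T4' g M lam s n r
  · exact Or.inl (key h')
  · right
    obtain ⟨hx3, j, hj2, hjg, heq, hnr⟩ := hx.resolve_left h'
    obtain ⟨k, h1, h2⟩ := exists_index (x := x) hj2 hjg
    rw [h1] at heq hnr
    rw [h2] at heq
    have hno : ∀ i : Fin (2 * g + 4), 3 ≤ (i : ℕ) → x i ∉ r := fun i hi hir =>
      h' (mem_T4'_of_pair hx3 hi hir k hnr (heq ▸ hnr))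
    exact ⟨k, hno ⟨3, by omega⟩ le_rfl, heq,
      fun l => ⟨hno _ (by simp only; omega), hno _ (by simp only; omega)⟩⟩

/-- The ranges of `x₄` in the three kinds of tuples making up `T4`. -/
def fourthRange (r : Finset ℕ) : Fin g ⊕ (Fin g × Fin g) ⊕ Fin g → ℕ → Finset ℕ
  | .inl _, N => (Finset.Icc 1 N).filter (· ∈ r)
  | .inr (.inl (i, j)), N => if i ≠ j then Finset.Icc 1 N else ∅
  | .inr (.inr _), N => Finset.Icc 1 N \ r

/-- The ranges of the pairs in the three kinds of tuples making up `T4`. -/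
def pairRange (r : Finset ℕ) :
    Fin g ⊕ (Fin g × Fin g) ⊕ Fin g → ℕ → ℕ → Fin g → Finset ℕ
  | .inl j, N, u, k => if k = j then pairsOut r N u else Finset.Icc u N
  | .inr (.inl (i, j)), N, u, k =>
      if k = i then pairsIn r N u else if k = j then pairsOut r N u else Finset.Icc u N
  | .inr (.inr j), N, u, k => if k = j then pairsEq r N u else pairsOut r N u

lemma T4_mem_range (hx : x ∈ T4 g M lam s n r) (hT : x ∈ Tn g M lam s n) :
    ∃ c : Fin g ⊕ (Fin g × Fin g) ⊕ Fin g, fourth x ∈ fourthRange r c (head x) ∧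
      ∀ k, pairLeft x k ∈ pairRange r c (head x) (fourth x) k := by
  have hu := fourth_mem hT
  rcases T4_cases hx with ⟨j, h4, hj⟩ | ⟨i, j, hij, hi, hj⟩ | ⟨j, h4, heq, hall⟩
  · refine ⟨.inl j, Finset.mem_filter.2 ⟨hu, h4⟩, fun k => ?_⟩
    simp only [pairRange]
    split_ifs with hk
    · rw [hk]; exact (mem_pairsOut_iff hT j).2 hj
    · exact pairLeft_mem hT k
  · refine ⟨.inr (.inl (i, j)), by simpa only [fourthRange, if_pos hij] using hu, fun k => ?_⟩
    simp only [pairRange]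
    split_ifs with hk hk'
    · rw [hk]; exact (mem_pairsIn_iff hT i).2 hi
    · rw [hk']; exact (mem_pairsOut_iff hT j).2 hj
    · exact pairLeft_mem hT k
  · refine ⟨.inr (.inr j), Finset.mem_sdiff.2 ⟨hu, h4⟩, fun k => ?_⟩
    simp only [pairRange]
    split_ifs with hk
    · rw [hk]
      have hs := pair_sum hT j
      exact Finset.mem_filter.2 ⟨pairLeft_mem hT j, by omega, (hall j).1⟩
    · exact (mem_pairsOut_iff hT k).2 (hall k)

/-- A bound, up to a power of `N`, for each of the three parts of the sum over `T4`. -/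
def T4Const (g : ℕ) (al K : ℝ) : ℝ :=
  K * outConst al * allConst al K ^ g + inConst al K * outConst al * allConst al K ^ g +
    (1 - al)⁻¹ * 2 ^ al * outConst al ^ (g - 1)

lemma T4Const_nonneg {al K : ℝ} (hal1 : al < 1) (hK1 : 1 ≤ K) : 0 ≤ T4Const g al K := by
  have h1 := one_le_allConst hal1 hK1
  have h2 := outConst_nonneg hal1
  have h3 := inConst_nonneg (al := al) (show 0 ≤ K by linarith)
  have h4 : 0 < 1 - al := by linarith
  unfold T4Const; positivity

lemma sum_ranges_le {al K : ℝ} {N : ℕ} (hg : 2 ≤ g) (hal : 1 / 2 < al) (hal1 : al < 1)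
    (hK : (r.card : ℝ) ≤ K) (hK1 : 1 ≤ K) (hN : 1 ≤ N)
    (c : Fin g ⊕ (Fin g × Fin g) ⊕ Fin g) :
    ∑ u ∈ fourthRange r c N, wt al r u *
      ∏ k, ∑ a ∈ pairRange r c N u k, pairWt al r (N + u) a ≤
      T4Const g al K * (N : ℝ) ^ (1 - 2 * al) := by
  have h1 : 0 ≤ allConst al K := by linarith [one_le_allConst hal1 hK1]
  have h2 := outConst_nonneg hal1
  have h3 := inConst_nonneg (al := al) (show 0 ≤ K by linarith)
  have h4 : 0 < 1 - al := by linarith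
  have e1 : 0 ≤ K * outConst al * allConst al K ^ g := by positivity
  have e2 : 0 ≤ inConst al K * outConst al * allConst al K ^ g := by positivity
  have e3 : 0 ≤ (1 - al)⁻¹ * 2 ^ al * outConst al ^ (g - 1) := by positivity
  have hp : 0 ≤ (N : ℝ) ^ (1 - 2 * al) := by positivity
  rcases c with j | ⟨i, j⟩ | j
  · refine (sum_mem_out_le hal hal1 hK hK1 hN j).trans (mul_le_mul_of_nonneg_right ?_ hp)
    unfold T4Const; linarith
  · by_cases hij : i ≠ j
    · simp only [fourthRange, if_pos hij]
      refine (sum_in_out_le hal hal1 hK hK1 hN hij).trans (mul_le_mul_of_nonneg_right ?_ hp)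
      unfold T4Const; linarith
    · simp only [fourthRange, if_neg hij, Finset.sum_empty]
      exact mul_nonneg (T4Const_nonneg hal1 hK1) hp
  · refine (sum_eq_out_le hg hal hal1 hN j).trans (mul_le_mul_of_nonneg_right ?_ hp)
    unfold T4Const; linarith

end Main

theorem stmt13 (g M : ℕ) (hg : 2 ≤ g) (hM : 1 ≤ M) (CM : Set (ZMod M))
    (hSidon : IsSidonZ CM) (hcov : Covers3 CM) :
    ∃ δ : ℝ, 0 < δ ∧
      ∀ s : ℕ → Fin 3 → ZMod M, GoodS M CM s →
      ∀ lam : ℝ, 1 < lam → ∃ C : ℝ, 0 < C ∧ ∃ n₀ : ℕ, ∀ n : ℕ, n₀ ≤ n →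
        ∀ r : Finset ℕ, (∀ a ∈ r, 1 ≤ a ∧ a ≤ n) → 3 ≤ r.card → r.card ≤ 2 * g + 4 →
          ((∑' x : ↥(T4 g M lam s n r),
              ∏ y ∈ imgF x.1 \ r, lam⁻¹ * (y : ℝ) ^ (-alph g)) ≤ C * (n : ℝ) ^ (-δ)) ∧
          ((∑' x : ↥(T5 g M lam s n r),
              ∏ y ∈ imgF x.1 \ r, lam⁻¹ * (y : ℝ) ^ (-alph g)) ≤ C) := by
  have hal := half_lt_alph (g := g)
  have hal1 := alph_lt_one hg
  have hkey := one_sub_alph (g := g)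
  have hg0 : (0 : ℝ) < g := by exact_mod_cast (show 0 < g by omega)
  set al := alph g
  set K : ℝ := 2 * g + 4 with hKdef
  have hK1 : 1 ≤ K := by linarith
  have h1 : 0 < 1 - al := by linarith
  have hD := outConst_nonneg hal1
  have hB := one_le_allConst hal1 hK1
  have hI := inConst_nonneg (al := al) (show 0 ≤ K by linarith)
  have hT4 := T4Const_nonneg (g := g) hal1 hK1
  set P : ℝ := outConst al ^ g * (1 - al)⁻¹ + inConst al K * allConst al K ^ g with hP
  have hP0 : 0 ≤ P := by positivity
  set ι := Fin g ⊕ (Fin g × Fin g) ⊕ Fin g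
  set E : ℝ := (4 : ℝ) ^ (2 * al - 1) with hE
  set C₄ : ℝ := Fintype.card ι * (K ^ 3 * (T4Const g al K * E)) with hC₄
  set C₅ : ℝ := Fintype.card Bool * (K ^ 3 * P) with hC₅
  have hC₄0 : 0 ≤ C₄ := by positivity
  have hC₅0 : 0 ≤ C₅ := by positivity
  refine ⟨(2 * al - 1) / g, div_pos (by linarith) hg0, fun s _ lam hlam =>
    ⟨C₄ + C₅ + 1, by positivity, 3, fun n hn r hr _ hcard => ?_⟩⟩
  have hn0 : (0 : ℝ) < n := by exact_mod_cast (show 0 < n by omega)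
  have hK : (r.card : ℝ) ≤ K := by rw [hKdef]; exact_mod_cast hcard
  set L : ℝ := (n : ℝ) ^ ((1 : ℝ) / g) / 4 with hL
  have hL0 : 0 < L := by positivity
  set R := r.filter fun N : ℕ => L ≤ (N : ℝ) with hR
  have hN1 : ∀ N ∈ R, 1 ≤ N := fun N hN => (hr N (Finset.mem_filter.1 hN).1).1
  have hhead : ∀ x ∈ T3 g M lam s n r, head x ∈ R := fun x hx =>
    Finset.mem_filter.2 ⟨hx.2.1, head_lower_bound hg hlam hn hx.1⟩
  have hLpow : L ^ (1 - 2 * al) = E * (n : ℝ) ^ (-((2 * al - 1) / g)) := by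
    rw [hL, hE, Real.div_rpow (by positivity) (by norm_num), ← Real.rpow_mul hn0.le,
      show 1 - 2 * al = -(2 * al - 1) by ring, Real.rpow_neg (by norm_num : (0 : ℝ) ≤ 4),
      div_inv_eq_mul, mul_comm]
    congr 2
    ring
  have hfin₃ := T3_finite (g := g) (lam := lam) (s := s) hr
  have hfin₄ : (T4 g M lam s n r).Finite :=
    hfin₃.subset (Set.union_subset (fun _ h => h.1) fun _ h => h.1)
  have hfin₅ : (T5 g M lam s n r).Finite := hfin₃.subset Set.sdiff_subset
  have hmem₃ : ∀ x ∈ T4 g M lam s n r, x ∈ T3 g M lam s n r := fun x h =>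
    h.elim (fun h => h.1) fun h => h.1
  constructor
  · rw [tsum_subset_eq_sum hfin₄ fun x => ∏ y ∈ imgF x \ r, lam⁻¹ * (y : ℝ) ^ (-al)]
    calc _ ≤ Fintype.card ι * (K ^ 3 * (T4Const g al K * L ^ (1 - 2 * al))) := by
          refine sum_tuples_le_of_cover (M := M) (n := n) (s := s) (by linarith) hlam _ R
            (Finset.filter_subset _ _)
            (fourthRange r) (pairRange r) (fun x hx => ?_) (fun x hx => ?_) (by positivity) hK
            fun c N hN => ?_
          · have := hmem₃ x (hfin₄.mem_toFinset.1 hx)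
            exact ⟨this, hhead x this⟩
          · have hx4 := hfin₄.mem_toFinset.1 hx
            exact T4_mem_range hx4 (hmem₃ x hx4).1
          · refine (sum_ranges_le hg hal hal1 hK hK1 (hN1 N hN) c).trans
              (mul_le_mul_of_nonneg_left ?_ hT4)
            exact Real.rpow_le_rpow_of_nonpos hL0 (Finset.mem_filter.1 hN).2 (by linarith)
      _ = C₄ * (n : ℝ) ^ (-((2 * al - 1) / g)) := by rw [hLpow, hC₄]; ring
      _ ≤ _ := by gcongr; linarith
  · rw [tsum_subset_eq_sum hfin₅ fun x => ∏ y ∈ imgF x \ r, lam⁻¹ * (y : ℝ) ^ (-al)]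
    calc _ ≤ C₅ := by
          refine sum_tuples_le_of_cover (M := M) (n := n) (s := s) (ι := Bool) (by linarith) hlam _ R
            (Finset.filter_subset _ _)
            (fun c N => if c then Finset.Icc 1 N \ r else Finset.Icc 1 N)
            (fun c N u _ => if c then pairsOut r N u else pairsIn r N u)
            (fun x hx => ?_) (fun x hx => ?_) hP0 hK fun c N hN => ?_
          · have := (hfin₅.mem_toFinset.1 hx).1
            exact ⟨this, hhead x this⟩
          · have hx5 := hfin₅.mem_toFinset.1 hx
            have hT := hx5.1.1
            rcases T5_cases hx5 with ⟨h4, h⟩ | h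
            · exact ⟨true, Finset.mem_sdiff.2 ⟨fourth_mem hT, h4⟩,
                fun k => (mem_pairsOut_iff hT k).2 (h k)⟩
            · exact ⟨false, fourth_mem hT, fun k => (mem_pairsIn_iff hT k).2 (h k)⟩
          · cases c
            · refine (sum_all_in_le hg hal hal1 hK hK1 (hN1 N hN)).trans ?_
              rw [hP]
              exact le_add_of_nonneg_left (by positivity)
            · refine (sum_all_out_le hal hal1 hkey (hN1 N hN)).trans ?_
              rw [hP]
              exact le_add_of_nonneg_right (by positivity)
      _ ≤ _ := by linarith
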